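/- Define the exterior and interior Dirichlet-to-Neumann maps Λ⁺ = (−I/2 + D')S⁻¹ and Λ⁻ = (I/2 + D')S⁻¹. Then for each choice of sign: (∓I/2 + D')S⁻¹ = S⁻¹(∓I/2 + D) = ∓H ∓ (∓I/2 + D')S⁻¹(∓I/2 + D). Moreover, if u ∈ ℝ^V satisfies (L(σ)u)|_{Ω⁻} = 0 then γ₁⁻u = Λ⁻ γ₀u, and if v ∈ ℝ^V satisfies (L(σ)v)|_{Ω⁺} = 0 and v|_B = 0 then γ₁⁺v = Λ⁺ γ₀v. -/

import Mathlib

open Matrix BigOperators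

noncomputable section

variable {V : Type*} [Fintype V] [DecidableEq V]

/-- Weighted graph Laplacian of a symmetric weight function. -/
def lap (σ : V → V → ℝ) : Matrix V V ℝ :=
  Matrix.of fun x y => if x = y then ∑ z, σ x z else -σ x y

/-- Restriction matrix `R_X : ℝ^V → ℝ^X`. -/
def restr (X : Finset V) : Matrix {x // x ∈ X} V ℝ :=
  Matrix.of fun i j => if (i : V) = j then 1 else 0

/-- Green function `G = R_{V°}ᵀ (L[V°,V°])⁻¹ R_{V°}` with `V° = Bᶜ`. -/
def green (B : Finset V) (σ : V → V → ℝ) : Matrix V V ℝ :=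
  (restr Bᶜ)ᵀ * (restr Bᶜ * lap σ * (restr Bᶜ)ᵀ)⁻¹ * restr Bᶜ

/-- Dirichlet trace operator `γ₀ = R_{∂Ω}`. -/
def gamma0 (dO : Finset V) : Matrix {x // x ∈ dO} V ℝ := restr dO

/-- Exterior Neumann trace operator `γ₁⁺ = -R_{∂Ω} L(σ⁺)`. -/
def gamma1p (dO : Finset V) (σp : V → V → ℝ) : Matrix {x // x ∈ dO} V ℝ :=
  -(restr dO * lap σp)

/-- Interior Neumann trace operator `γ₁⁻ = R_{∂Ω} L(σ⁻)`. -/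
def gamma1m (dO : Finset V) (σm : V → V → ℝ) : Matrix {x // x ∈ dO} V ℝ :=
  restr dO * lap σm

/-- Single layer potential `𝒮 = G γ₀ᵀ`. -/
def slp (B dO : Finset V) (σ : V → V → ℝ) : Matrix V {x // x ∈ dO} ℝ :=
  green B σ * (gamma0 dO)ᵀ

/-- Exterior double layer potential `𝒟⁺ = G (γ₁⁺)ᵀ`. -/
def dlpP (B dO : Finset V) (σ σp : V → V → ℝ) : Matrix V {x // x ∈ dO} ℝ :=
  green B σ * (gamma1p dO σp)ᵀ

/-- Interior double layer potential `𝒟⁻ = G (γ₁⁻)ᵀ`. -/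
def dlpM (B dO : Finset V) (σ σm : V → V → ℝ) : Matrix V {x // x ∈ dO} ℝ :=
  green B σ * (gamma1m dO σm)ᵀ

/-- Single layer boundary operator `S = γ₀ 𝒮`. -/
def Sop (B dO : Finset V) (σ : V → V → ℝ) : Matrix {x // x ∈ dO} {x // x ∈ dO} ℝ :=
  gamma0 dO * slp B dO σ

/-- Double layer boundary operator `D = ½ γ₀ (𝒟⁺ + 𝒟⁻)`. -/
def Dop (B dO : Finset V) (σ σp σm : V → V → ℝ) : Matrix {x // x ∈ dO} {x // x ∈ dO} ℝ :=
  (1/2 : ℝ) • (gamma0 dO * (dlpP B dO σ σp + dlpM B dO σ σm))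

/-- Adjoint double layer (Neumann–Poincaré) operator `D' = ½ (γ₁⁺ + γ₁⁻) 𝒮`. -/
def Dadj (B dO : Finset V) (σ σp σm : V → V → ℝ) : Matrix {x // x ∈ dO} {x // x ∈ dO} ℝ :=
  (1/2 : ℝ) • ((gamma1p dO σp + gamma1m dO σm) * slp B dO σ)

/-- Hypersingular operator `H = -γ₁⁺ 𝒟⁻`. -/
def Hop (B dO : Finset V) (σ σp σm : V → V → ℝ) : Matrix {x // x ∈ dO} {x // x ∈ dO} ℝ :=
  -(gamma1p dO σp * dlpM B dO σ σm)

/-- Indicator vector of a node subset. -/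
def ind (X : Finset V) : V → ℝ := fun x => if x ∈ X then 1 else 0

/-- The subgraph with node set `A` and edges `{x,y}` with `w x y > 0` is connected. -/
def connOn (A : Finset V) (w : V → V → ℝ) : Prop :=
  ∀ x ∈ A, ∀ y ∈ A, Relation.ReflTransGen (fun a b => a ∈ A ∧ b ∈ A ∧ 0 < w a b) x y

theorem lap_mulVec_apply (w : V → V → ℝ) (hd : ∀ x, w x x = 0) (u : V → ℝ) (x : V) :
    (lap w *ᵥ u) x = ∑ y, w x y * (u x - u y) := by
  have h : ∀ y, lap w x y * u y = (if x = y then (∑ z, w x z) * u x else 0) - w x y * u y := by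
    intro y
    by_cases hxy : x = y
    · subst hxy; simp [lap, hd]
    · simp [lap, hxy]
  simp only [mulVec, dotProduct, h, Finset.sum_sub_distrib, mul_sub, Finset.sum_mul,
    Finset.sum_ite_eq, Finset.mem_univ, if_true]

theorem lap_transpose (w : V → V → ℝ) (hs : ∀ x y, w x y = w y x) : (lap w)ᵀ = lap w := by
  ext x y
  by_cases h : x = y
  · subst h; simp [lap]
  · simp [lap, h, Ne.symm h, hs x y]

theorem lap_add (w₁ w₂ w : V → V → ℝ) (h : ∀ x y, w₁ x y + w₂ x y = w x y) :
    lap w = lap w₁ + lap w₂ := by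
  ext x y
  by_cases hxy : x = y
  · simp [lap, hxy, ← h, Finset.sum_add_distrib]
  · simp [lap, hxy, ← h]; ring

theorem restr_mulVec (X : Finset V) (u : V → ℝ) (i : {x // x ∈ X}) :
    (restr X *ᵥ u) i = u i := by
  simp [restr, mulVec, dotProduct]

theorem restr_mul {n : Type*} (X : Finset V) (M : Matrix V n ℝ) (i : {x // x ∈ X}) (j : n) :
    (restr X * M) i j = M i j := by
  simp [restr, mul_apply]

theorem restr_transpose_mulVec {V : Type*} [DecidableEq V] (X : Finset V) (f : {x // x ∈ X} → ℝ) (x : V) :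
    ((restr X)ᵀ *ᵥ f) x = if h : x ∈ X then f ⟨x, h⟩ else 0 := by
  split_ifs with h
  · simp only [restr, mulVec, dotProduct, transpose_apply, of_apply]
    rw [Finset.sum_eq_single ⟨x, h⟩] <;> simp +contextual [Subtype.ext_iff]
  · simp only [restr, mulVec, dotProduct, transpose_apply, of_apply]
    refine Finset.sum_eq_zero fun i _ => ?_
    rw [if_neg (fun e : (i : V) = x => h (e ▸ i.2)), zero_mul]

theorem restr_mul_transpose (X : Finset V) : restr X * (restr X)ᵀ = 1 := by
  ext i j
  rw [restr_mul, transpose_apply, restr, of_apply, one_apply]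
  simp only [Subtype.ext_iff, eq_comm]

theorem restr_transpose_mulVec_restr_mulVec (X : Finset V) (u : V → ℝ) (h : ∀ x ∉ X, u x = 0) :
    (restr X)ᵀ *ᵥ (restr X *ᵥ u) = u := by
  ext x
  rw [restr_transpose_mulVec]
  split_ifs with hx
  · exact restr_mulVec X u ⟨x, hx⟩
  · exact (h x hx).symm

theorem eq_zero_of_mul_lap_mulVec_eq_zero (B : Finset V) (w : V → V → ℝ)
    (hpd : (restr Bᶜ * lap w * (restr Bᶜ)ᵀ).PosDef) (u : V → ℝ) (hB : ∀ x ∈ B, u x = 0)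
    (hu : ∀ x, u x * (lap w *ᵥ u) x = 0) : u = 0 := by
  have hext := restr_transpose_mulVec_restr_mulVec Bᶜ u (by simpa using hB)
  by_contra hne
  have hne' : restr Bᶜ *ᵥ u ≠ 0 := by
    intro h
    rw [h, mulVec_zero] at hext
    exact hne hext.symm
  have hpos := hpd.dotProduct_mulVec_pos hne'
  rw [← mulVec_mulVec, hext, ← mulVec_mulVec] at hpos
  refine hpos.ne' ?_
  rw [dotProduct]
  refine Finset.sum_eq_zero fun i _ => ?_
  simpa [restr_mulVec] using hu i

theorem eq_zero_on_of_lap_mulVec_eq_zero (B X : Finset V) (w : V → V → ℝ) (hd : ∀ x, w x x = 0)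
    (hpd : (restr Bᶜ * lap w * (restr Bᶜ)ᵀ).PosDef) (hXB : Disjoint B X) (u : V → ℝ)
    (hu : ∀ x ∈ X, (lap w *ᵥ u) x = 0) (hout : ∀ x ∈ X, ∀ y ∉ X, w x y * u y = 0) :
    ∀ x ∈ X, u x = 0 := by
  have key := eq_zero_of_mul_lap_mulVec_eq_zero B w hpd (fun x => if x ∈ X then u x else 0)
    (fun x hx => if_neg (Finset.disjoint_left.mp hXB hx)) (fun x => by
      by_cases hx : x ∈ X
      · refine mul_eq_zero_of_right _ ?_
        refine Eq.trans ?_ (hu x hx)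
        rw [lap_mulVec_apply _ hd, lap_mulVec_apply _ hd]
        refine Finset.sum_congr rfl fun y _ => ?_
        by_cases hy : y ∈ X
        · simp [hx, hy]
        · simp [hx, hy, mul_sub, hout x hx y hy]
      · simp [hx])
  intro x hx
  simpa [hx] using congrFun key x

theorem lap_mul_green (B : Finset V) (w : V → V → ℝ)
    (hpd : (restr Bᶜ * lap w * (restr Bᶜ)ᵀ).PosDef) :
    restr Bᶜ * (lap w * green B w) = restr Bᶜ := by
  have h := Matrix.mul_nonsing_inv _ ((Matrix.isUnit_iff_isUnit_det _).mp hpd.isUnit)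
  calc restr Bᶜ * (lap w * green B w)
      = (restr Bᶜ * lap w * (restr Bᶜ)ᵀ) * (restr Bᶜ * lap w * (restr Bᶜ)ᵀ)⁻¹ * restr Bᶜ := by
        simp only [green, Matrix.mul_assoc]
    _ = restr Bᶜ := by rw [h, Matrix.one_mul]

theorem lap_mul_green_apply (B : Finset V) (w : V → V → ℝ)
    (hpd : (restr Bᶜ * lap w * (restr Bᶜ)ᵀ).PosDef) {n : Type*} (M : Matrix V n ℝ)
    (x : V) (hx : x ∉ B) (j : n) : (lap w * (green B w * M)) x j = M x j := by
  have h := congrArg (· * M) (lap_mul_green B w hpd)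
  simp only [Matrix.mul_assoc] at h
  have h' := congrFun (congrFun h ⟨x, by simpa using hx⟩) j
  simpa only [restr_mul] using h'

theorem restr_mul_lap_mul_green (B X : Finset V) (hX : Disjoint B X) (w : V → V → ℝ)
    (hpd : (restr Bᶜ * lap w * (restr Bᶜ)ᵀ).PosDef) {n : Type*} (M : Matrix V n ℝ) :
    restr X * (lap w * (green B w * M)) = restr X * M := by
  ext i j
  rw [restr_mul, restr_mul, lap_mul_green_apply B w hpd _ _ (Finset.disjoint_right.mp hX i.2)]

theorem green_transpose (B : Finset V) (w : V → V → ℝ) (hs : ∀ x y, w x y = w y x) :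
    (green B w)ᵀ = green B w := by
  simp only [green, transpose_mul, transpose_transpose, transpose_nonsing_inv, lap_transpose w hs,
    Matrix.mul_assoc]

theorem green_mul_apply_of_mem (B : Finset V) (w : V → V → ℝ) {n : Type*} (M : Matrix V n ℝ)
    (x : V) (hx : x ∈ B) (j : n) : (green B w * M) x j = 0 := by
  simp only [green, Matrix.mul_assoc]
  rw [mul_apply]
  refine Finset.sum_eq_zero fun i _ => ?_
  have : ¬ ((i : V) = x) := by
    rintro rfl
    exact (Finset.mem_compl.mp i.2) hx
  simp [restr, this]

theorem slp_mulVec_of_mem (B X : Finset V) (w : V → V → ℝ) (f : {x // x ∈ X} → ℝ)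
    (x : V) (hx : x ∈ B) : (slp B X w *ᵥ f) x = 0 := by
  refine Finset.sum_eq_zero fun i _ => ?_
  have h : slp B X w x i = 0 := green_mul_apply_of_mem B w _ x hx i
  simp only [h, zero_mul]

theorem lap_mulVec_slp_mulVec (B X : Finset V) (w : V → V → ℝ)
    (hpd : (restr Bᶜ * lap w * (restr Bᶜ)ᵀ).PosDef) (f : {x // x ∈ X} → ℝ)
    (x : V) (hx : x ∉ B) : (lap w *ᵥ (slp B X w *ᵥ f)) x = ((restr X)ᵀ *ᵥ f) x := by
  rw [mulVec_mulVec]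
  refine Finset.sum_congr rfl fun i _ => ?_
  have h : (lap w * slp B X w) x i = (restr X)ᵀ x i := lap_mul_green_apply B w hpd _ x hx i
  simp only [h]

theorem isUnit_det_Sop (B X : Finset V) (hX : Disjoint B X) (w : V → V → ℝ)
    (hpd : (restr Bᶜ * lap w * (restr Bᶜ)ᵀ).PosDef) : IsUnit (Sop B X w).det := by
  rw [← Matrix.isUnit_iff_isUnit_det, ← Matrix.mulVec_injective_iff_isUnit,
    ← Matrix.coe_mulVecLin, ← LinearMap.ker_eq_bot, LinearMap.ker_eq_bot']
  intro f hf
  rw [Matrix.mulVecLin_apply] at hf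
  have hu : slp B X w *ᵥ f = 0 := by
    refine eq_zero_of_mul_lap_mulVec_eq_zero B w hpd _ (fun x hx => ?_) fun x => ?_
    · exact slp_mulVec_of_mem B X w f x hx
    · by_cases hxX : x ∈ X
      · have h : restr X *ᵥ (slp B X w *ᵥ f) = 0 := by rw [mulVec_mulVec]; exact hf
        have h' := congrFun h ⟨x, hxX⟩
        rw [restr_mulVec] at h'
        rw [h']
        exact zero_mul _
      by_cases hxB : x ∈ B
      · rw [slp_mulVec_of_mem B X w f x hxB, zero_mul]
      · rw [lap_mulVec_slp_mulVec B X w hpd f x hxB, restr_transpose_mulVec, dif_neg hxX, mul_zero]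
  ext i
  have h := lap_mulVec_slp_mulVec B X w hpd f i (Finset.disjoint_right.mp hX i.2)
  rw [hu, mulVec_zero, restr_transpose_mulVec, dif_pos i.2] at h
  exact h.symm

/-- The Neumann trace from the side of `Y` of a function harmonic on `Y` is that of the single
layer potential with the same Dirichlet trace on `X`. -/
theorem restr_lap_mulVec_eq_slp (B Y X : Finset V) (w w' : V → V → ℝ)
    (hBX : Disjoint B X) (hBY : Disjoint B Y) (hYX : Disjoint Y X)
    (hd : ∀ x, w x x = 0) (hd' : ∀ x, w' x x = 0)
    (hpd : (restr Bᶜ * lap w * (restr Bᶜ)ᵀ).PosDef)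
    (u : V → ℝ) (hu : ∀ x ∈ Y, (lap w *ᵥ u) x = 0)
    (hout : ∀ x ∈ Y, ∀ y ∉ Y, y ∉ X → w x y = 0 ∨ y ∈ B ∧ u y = 0)
    (hout' : ∀ x ∈ X, ∀ y ∉ Y, y ∉ X → w' x y = 0) :
    (restr X * lap w') *ᵥ u =
      ((restr X * lap w') * slp B X w * (Sop B X w)⁻¹) *ᵥ (gamma0 X *ᵥ u) := by
  set f := (Sop B X w)⁻¹ *ᵥ (gamma0 X *ᵥ u) with hf
  set v := u - slp B X w *ᵥ f with hv
  have hvX : ∀ x ∈ X, v x = 0 := by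
    intro x hx
    have h : restr X *ᵥ (slp B X w *ᵥ f) = restr X *ᵥ u := by
      rw [hf, mulVec_mulVec, mulVec_mulVec]
      change (Sop B X w * (Sop B X w)⁻¹) *ᵥ _ = _
      rw [Matrix.mul_nonsing_inv _ (isUnit_det_Sop B X hBX w hpd), one_mulVec]
      rfl
    have h' := congrFun h ⟨x, hx⟩
    rw [restr_mulVec, restr_mulVec] at h'
    rw [hv, Pi.sub_apply, sub_eq_zero]
    exact h'.symm
  have hvY : ∀ x ∈ Y, v x = 0 := by
    refine eq_zero_on_of_lap_mulVec_eq_zero B Y w hd hpd hBY v (fun x hx => ?_)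
      fun x hx y hy => ?_
    · rw [hv, mulVec_sub, Pi.sub_apply, hu x hx,
        lap_mulVec_slp_mulVec B X w hpd f x (Finset.disjoint_right.mp hBY hx),
        restr_transpose_mulVec, dif_neg (Finset.disjoint_left.mp hYX hx), sub_zero]
    · by_cases hyX : y ∈ X
      · rw [hvX y hyX, mul_zero]
      · rcases hout x hx y hy hyX with h | ⟨hyB, h⟩
        · rw [h, zero_mul]
        · rw [hv, Pi.sub_apply, h, slp_mulVec_of_mem B X w f y hyB, sub_zero, mul_zero]
  have hzero : (restr X * lap w') *ᵥ v = 0 := by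
    ext i
    rw [← mulVec_mulVec, restr_mulVec, lap_mulVec_apply _ hd']
    refine Finset.sum_eq_zero fun y _ => ?_
    by_cases hyX : y ∈ X
    · rw [hvX i i.2, hvX y hyX, sub_zero, mul_zero]
    by_cases hyY : y ∈ Y
    · rw [hvX i i.2, hvY y hyY, sub_zero, mul_zero]
    · rw [hout' i i.2 y hyY hyX, zero_mul]
  rw [hv, mulVec_sub, sub_eq_zero] at hzero
  rw [hzero, hf, mulVec_mulVec, mulVec_mulVec]

theorem stmt_13
    {V : Type*} [Fintype V] [DecidableEq V]
    (B Op dO Om : Finset V)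
    (hBne : B.Nonempty) (hOpne : Op.Nonempty) (hdOne : dO.Nonempty) (hOmne : Om.Nonempty)
    (hd1 : Disjoint B Op) (hd2 : Disjoint B dO) (hd3 : Disjoint B Om)
    (hd4 : Disjoint Op dO) (hd5 : Disjoint Op Om) (hd6 : Disjoint dO Om)
    (hcover : B ∪ Op ∪ dO ∪ Om = Finset.univ)
    (σ σp σm : V → V → ℝ)
    (hσsymm : ∀ x y, σ x y = σ y x) (hσdiag : ∀ x, σ x x = 0)
    (hσnn : ∀ x y, 0 ≤ σ x y)
    (hsepBdO : ∀ x ∈ B, ∀ y ∈ dO, σ x y = 0)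
    (hsepBOm : ∀ x ∈ B, ∀ y ∈ Om, σ x y = 0)
    (hsepOpOm : ∀ x ∈ Op, ∀ y ∈ Om, σ x y = 0)
    (hσpsymm : ∀ x y, σp x y = σp y x) (hσpdiag : ∀ x, σp x x = 0)
    (hσmsymm : ∀ x y, σm x y = σm y x) (hσmdiag : ∀ x, σm x x = 0)
    (hσpnn : ∀ x y, 0 ≤ σp x y) (hσmnn : ∀ x y, 0 ≤ σm x y)
    (hsum : ∀ x y, σp x y + σm x y = σ x y)
    (hp1 : ∀ x y, x ∈ B ∪ Op ∨ y ∈ B ∪ Op → σp x y = σ x y)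
    (hm1 : ∀ x y, x ∈ Om ∨ y ∈ Om → σm x y = σ x y)
    (hpd : (restr Bᶜ * lap σ * (restr Bᶜ)ᵀ).PosDef) :
    ∀ Lp Lm : Matrix {x // x ∈ dO} {x // x ∈ dO} ℝ,
      Lp = ((-(1/2) : ℝ) • 1 + Dadj B dO σ σp σm) * (Sop B dO σ)⁻¹ →
      Lm = (((1/2) : ℝ) • 1 + Dadj B dO σ σp σm) * (Sop B dO σ)⁻¹ →
      (Lp = (Sop B dO σ)⁻¹ * ((-(1/2) : ℝ) • 1 + Dop B dO σ σp σm)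
      ∧ Lp = -(Hop B dO σ σp σm)
            - ((-(1/2) : ℝ) • 1 + Dadj B dO σ σp σm) * (Sop B dO σ)⁻¹
              * ((-(1/2) : ℝ) • 1 + Dop B dO σ σp σm)
      ∧ Lm = (Sop B dO σ)⁻¹ * (((1/2) : ℝ) • 1 + Dop B dO σ σp σm)
      ∧ Lm = Hop B dO σ σp σm
            + (((1/2) : ℝ) • 1 + Dadj B dO σ σp σm) * (Sop B dO σ)⁻¹
              * (((1/2) : ℝ) • 1 + Dop B dO σ σp σm)
      ∧ (∀ u : V → ℝ, (∀ x ∈ Om, (lap σ *ᵥ u) x = 0) →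
          gamma1m dO σm *ᵥ u = Lm *ᵥ (gamma0 dO *ᵥ u))
      ∧ (∀ v : V → ℝ, (∀ x ∈ Op, (lap σ *ᵥ v) x = 0) → (∀ x ∈ B, v x = 0) →
          gamma1p dO σp *ᵥ v = Lp *ᵥ (gamma0 dO *ᵥ v))) := by
  have hne : ∀ y, y ∉ Om → y ∉ dO → y ∈ B ∪ Op := by
    intro y h1 h2
    have h := Finset.mem_univ y
    rw [← hcover] at h
    simp only [Finset.mem_union] at h ⊢
    tauto
  have hne' : ∀ y, y ∉ Op → y ∉ dO → y ∈ B ∨ y ∈ Om := by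
    intro y h1 h2
    have h := Finset.mem_univ y
    rw [← hcover] at h
    simp only [Finset.mem_union] at h
    tauto
  have hσm0 : ∀ x, ∀ y ∈ B ∪ Op, σm x y = 0 := fun x y hy => by
    linarith [hsum x y, hp1 x y (Or.inr hy)]
  have hσp0 : ∀ x, ∀ y ∈ Om, σp x y = 0 := fun x y hy => by
    linarith [hsum x y, hm1 x y (Or.inr hy)]
  have hint : ∀ u : V → ℝ, (∀ x ∈ Om, (lap σ *ᵥ u) x = 0) → gamma1m dO σm *ᵥ u =
      (gamma1m dO σm * slp B dO σ * (Sop B dO σ)⁻¹) *ᵥ (gamma0 dO *ᵥ u) := by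
    intro u hu
    refine restr_lap_mulVec_eq_slp B Om dO σ σm hd2 hd3 hd6.symm hσdiag hσmdiag hpd u hu
      (fun x hx y hy hyd => Or.inl ?_) fun x _ y hy hyd => hσm0 x y (hne y hy hyd)
    rcases Finset.mem_union.mp (hne y hy hyd) with h | h
    · rw [hσsymm]; exact hsepBOm y h x hx
    · rw [hσsymm]; exact hsepOpOm y h x hx
  have hext : ∀ v : V → ℝ, (∀ x ∈ Op, (lap σ *ᵥ v) x = 0) → (∀ x ∈ B, v x = 0) →
      gamma1p dO σp *ᵥ v =
        (gamma1p dO σp * slp B dO σ * (Sop B dO σ)⁻¹) *ᵥ (gamma0 dO *ᵥ v) := by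
    intro v hv hvB
    have h := restr_lap_mulVec_eq_slp B Op dO σ σp hd2 hd1 hd4 hσdiag hσpdiag hpd v hv
      (fun x hx y hy hyd => (hne' y hy hyd).symm.imp (hsepOpOm x hx y) fun h => ⟨h, hvB y h⟩)
      (fun x hx y hy hyd => (hne' y hy hyd).elim
        (fun h => by rw [hp1 x y (Or.inr (Finset.mem_union_left _ h)), hσsymm, hsepBdO y h x hx])
        (hσp0 x y))
    simp only [gamma1p, Matrix.neg_mul, neg_mulVec, h]
  have hdet := isUnit_det_Sop B dO hd2 σ hpd
  have hlap := lap_add σp σm σ hsum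
  have hPLS : restr dO * (lap σ * slp B dO σ) = 1 := by
    rw [slp, restr_mul_lap_mul_green B dO hd2 σ hpd, gamma0, restr_mul_transpose]
  have hp : gamma1p dO σp = gamma1m dO σm - restr dO * lap σ := by
    rw [hlap, gamma1p, gamma1m, Matrix.mul_add]; abel
  have hpS : gamma1p dO σp * slp B dO σ = gamma1m dO σm * slp B dO σ - 1 := by
    rw [hp, Matrix.sub_mul, Matrix.mul_assoc (restr dO), hPLS]
  have hGt := green_transpose B σ hσsymm
  have hSt : (Sop B dO σ)ᵀ = Sop B dO σ := by
    simp only [Sop, slp, transpose_mul, transpose_transpose, hGt, Matrix.mul_assoc]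
  have hDt : Dop B dO σ σp σm = (Dadj B dO σ σp σm)ᵀ := by
    simp only [Dop, Dadj, dlpP, dlpM, slp, transpose_smul, transpose_mul, transpose_transpose,
      transpose_add, hGt, ← Matrix.mul_add, Matrix.mul_assoc]
  have hDadj : Dadj B dO σ σp σm = gamma1m dO σm * slp B dO σ - (1/2 : ℝ) • 1 := by
    rw [Dadj, Matrix.add_mul, hpS]
    module
  have hDop : Dop B dO σ σp σm = (gamma1m dO σm * slp B dO σ)ᵀ - (1/2 : ℝ) • 1 := by
    rw [hDt, hDadj, transpose_sub, transpose_smul, transpose_one]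
  set S := Sop B dO σ with hS
  set Λ := gamma1m dO σm * slp B dO σ * S⁻¹ with hΛ
  have hΛS : gamma1m dO σm * slp B dO σ = Λ * S := by
    rw [hΛ, Matrix.mul_assoc _ S⁻¹, Matrix.nonsing_inv_mul _ hdet, Matrix.mul_one]
  -- Green's identity for the harmonic extension `E`.
  have hΛt : Λᵀ = Λ := by
    set E := slp B dO σ * S⁻¹ with hE
    have hPE : restr dO * E = 1 := by
      rw [hE, ← Matrix.mul_assoc]
      exact Matrix.mul_nonsing_inv _ hdet
    have hrow : lap σm * E = (restr dO)ᵀ * Λ := by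
      have hΛE : Λ = restr dO * (lap σm * E) := by
        rw [hΛ, hE, gamma1m]; simp only [Matrix.mul_assoc]
      ext x j
      have hR : ((restr dO)ᵀ * Λ) x j = if h : x ∈ dO then Λ ⟨x, h⟩ j else 0 :=
        restr_transpose_mulVec dO (fun i => Λ i j) x
      have hm : (lap σm * E) x j = ∑ y, σm x y * (E x j - E y j) :=
        lap_mulVec_apply σm hσmdiag (fun y => E y j) x
      rw [hR]
      split_ifs with hx
      · rw [hΛE, restr_mul]
      by_cases hxO : x ∈ Om
      · have hs : (lap σ * E) x j = ∑ y, σ x y * (E x j - E y j) :=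
          lap_mulVec_apply σ hσdiag (fun y => E y j) x
        have h0 : (lap σ * E) x j = ((restr dO)ᵀ * S⁻¹) x j := by
          rw [hE, slp, Matrix.mul_assoc, lap_mul_green_apply B σ hpd _ x
            (Finset.disjoint_right.mp hd3 hxO)]
          rfl
        have h1 : ((restr dO)ᵀ * S⁻¹) x j = if h : x ∈ dO then S⁻¹ ⟨x, h⟩ j else 0 :=
          restr_transpose_mulVec dO (fun i => S⁻¹ i j) x
        rw [dif_neg hx] at h1
        rw [hm, ← h1, ← h0, hs]
        exact Finset.sum_congr rfl fun y _ => by rw [hm1 x y (Or.inl hxO)]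
      · rw [hm]
        refine Finset.sum_eq_zero fun y _ => ?_
        rw [hσmsymm, hσm0 y x (hne x hxO hx), zero_mul]
    have hquad : Λ = Eᵀ * (lap σm * E) := by
      rw [hrow, ← Matrix.mul_assoc, ← transpose_mul, hPE, transpose_one, Matrix.one_mul]
    rw [hquad]
    simp only [transpose_mul, transpose_transpose, lap_transpose σm hσmsymm, Matrix.mul_assoc]
  have hH : Λ = Hop B dO σ σp σm + Λ * S * Λ := by
    have hPD : gamma0 dO * dlpM B dO σ σm = S * Λ := by
      rw [← hSt, ← hΛt, ← transpose_mul, ← hΛS]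
      simp only [dlpM, slp, transpose_mul, transpose_transpose, hGt, Matrix.mul_assoc]
    have hcol : gamma1m dO σm * (dlpM B dO σ σm - (gamma0 dO)ᵀ) =
        Λ * (gamma0 dO * (dlpM B dO σ σm - (gamma0 dO)ᵀ)) := by
      ext i j
      refine congrFun (hint (fun y => (dlpM B dO σ σm - (gamma0 dO)ᵀ) y j) fun x hx => ?_) i
      change (lap σ * (dlpM B dO σ σm - (gamma0 dO)ᵀ)) x j = 0
      rw [Matrix.mul_sub, Matrix.sub_apply, dlpM, lap_mul_green_apply B σ hpd _ x
        (Finset.disjoint_right.mp hd3 hx), sub_eq_zero]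
      simp only [gamma1m, gamma0, transpose_mul, lap_transpose σm hσmsymm]
      refine (lap_mulVec_apply σm hσmdiag (fun y => (restr dO)ᵀ y j) x).trans
        (Eq.trans ?_ (lap_mulVec_apply σ hσdiag (fun y => (restr dO)ᵀ y j) x).symm)
      exact Finset.sum_congr rfl fun y _ => by rw [hm1 x y (Or.inl hx)]
    have hP : restr dO * (lap σ * dlpM B dO σ σm) = gamma1m dO σm * (gamma0 dO)ᵀ := by
      rw [dlpM, restr_mul_lap_mul_green B dO hd2 σ hpd]
      simp only [gamma1m, gamma0, transpose_mul, lap_transpose σm hσmsymm, Matrix.mul_assoc]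
    have hγ : gamma0 dO * (gamma0 dO)ᵀ = 1 := restr_mul_transpose dO
    rw [Matrix.mul_sub, Matrix.mul_sub, hPD, hγ, Matrix.mul_sub, Matrix.mul_one,
      ← Matrix.mul_assoc] at hcol
    rw [Hop, hp, Matrix.sub_mul, Matrix.mul_assoc (restr dO), hP, hcol]
    abel
  have hDadj1 : Dadj B dO σ σp σm = Λ * S - (1/2 : ℝ) • 1 := by rw [hDadj, hΛS]
  have hDop1 : Dop B dO σ σp σm = S * Λ - (1/2 : ℝ) • 1 := by
    rw [hDop, hΛS, transpose_mul, hSt, hΛt]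
  have e1 : (1/2 : ℝ) • 1 + Dadj B dO σ σp σm = Λ * S := by rw [hDadj1]; abel
  have e2 : (-(1/2) : ℝ) • 1 + Dadj B dO σ σp σm = Λ * S - 1 := by rw [hDadj1]; module
  have e3 : (1/2 : ℝ) • 1 + Dop B dO σ σp σm = S * Λ := by rw [hDop1]; abel
  have e4 : (-(1/2) : ℝ) • 1 + Dop B dO σ σp σm = S * Λ - 1 := by rw [hDop1]; module
  have c1 : S * S⁻¹ = 1 := Matrix.mul_nonsing_inv _ hdet
  have c2 : S⁻¹ * S = 1 := Matrix.nonsing_inv_mul _ hdet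
  have f1 : Λ * S * S⁻¹ = Λ := by rw [Matrix.mul_assoc, c1, Matrix.mul_one]
  have f2 : S⁻¹ * (S * Λ) = Λ := by rw [← Matrix.mul_assoc, c2, Matrix.one_mul]
  rintro Lp Lm rfl rfl
  rw [e1, e2, e3, e4, f1, Matrix.sub_mul, f1, Matrix.one_mul, Matrix.mul_sub, f2, Matrix.mul_one]
  refine ⟨rfl, ?_, rfl, ?_, hint, ?_⟩
  · rw [Matrix.sub_mul, Matrix.mul_sub, Matrix.mul_sub, f2, ← Matrix.mul_assoc Λ S Λ]
    rw [← sub_eq_zero]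
    have h0 := sub_eq_zero.mpr hH.symm
    rw [← h0]
    simp only [Matrix.mul_one]
    abel
  · rw [← Matrix.mul_assoc]; exact hH
  · intro v hv hvB
    rw [hext v hv hvB, hpS, Matrix.sub_mul, Matrix.one_mul]
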